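/- arXiv:2408.05880 — 5 statements merged into one kernel-verified Lean document; each statement's English description precedes it below -/
import Mathlib

section
/- Let c₁, c₂, c₃, c₄, c₅, c₆ be real constants satisfying 4·e^(2c₁) = c₂² + c₄². Define γ₁(s) = e^(−c₁)·c₂·arctan(e^(s−c₁)) + c₃, γ₂(s) = e^(−c₁)·c₄·arctan(e^(s−c₁)) + c₅, γ₃(s) = −s + ln(e^(2s) + e^(2c₁)) + c₆ for s ∈ ℝ. Then these functions satisfy the semi-symmetric geodesic equations of Euclidean 3-space: γ₁''(s) + γ₁'(s)·γ₃'(s) = 0, γ₂''(s) + γ₂'(s)·γ₃'(s) = 0, and γ₃''(s) + (γ₃'(s))² − 1 = 0 for all s ∈ ℝ. -/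
lemma hasDerivAt_arctan_exp_sub (c s : ℝ) :
    HasDerivAt (fun s => Real.arctan (Real.exp (s - c))) (1 / (2 * Real.cosh (s - c))) s := by
  refine ((hasDerivAt_id s).sub_const c).exp.arctan.congr_deriv ?_
  have he := Real.exp_pos (s - c)
  rw [Real.cosh_eq, Real.exp_neg]
  simp only [id]
  field_simp
  ring

lemma hasDerivAt_neg_add_log_exp_add_exp (c s : ℝ) :
    HasDerivAt (fun s => -s + Real.log (Real.exp (2 * s) + Real.exp (2 * c)))
      (Real.sinh (s - c) / Real.cosh (s - c)) s := by
  have hs := Real.exp_pos s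
  have hc := Real.exp_pos c
  have hne : Real.exp (2 * s) + Real.exp (2 * c) ≠ 0 := by positivity
  refine ((hasDerivAt_id s).neg.add
    ((((hasDerivAt_id s).const_mul 2).exp.add_const (Real.exp (2 * c))).log hne)).congr_deriv ?_
  rw [Real.sinh_eq, Real.cosh_eq, Real.exp_neg, Real.exp_sub]
  simp only [id, two_mul, Real.exp_add]
  field_simp
  ring

lemma deriv_const_mul_arctan_exp_sub (a b c : ℝ) :
    deriv (fun s => a * Real.arctan (Real.exp (s - c)) + b) =
      fun s => a * (1 / (2 * Real.cosh (s - c))) :=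
  funext fun s => (((hasDerivAt_arctan_exp_sub c s).const_mul a).add_const b).deriv

lemma deriv_neg_add_log_exp_add_exp (b c : ℝ) :
    deriv (fun s => -s + Real.log (Real.exp (2 * s) + Real.exp (2 * c)) + b) =
      fun s => Real.sinh (s - c) / Real.cosh (s - c) :=
  funext fun s => ((hasDerivAt_neg_add_log_exp_add_exp c s).add_const b).deriv

lemma deriv_deriv_arctan_exp_sub_add_mul (a b b' c s : ℝ) :
    deriv (deriv fun s => a * Real.arctan (Real.exp (s - c)) + b) s +
      deriv (fun s => a * Real.arctan (Real.exp (s - c)) + b) s *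
        deriv (fun s => -s + Real.log (Real.exp (2 * s) + Real.exp (2 * c)) + b') s = 0 := by
  have hcosh : Real.cosh (s - c) ≠ 0 := (Real.cosh_pos _).ne'
  have h : HasDerivAt (fun s => a * (1 / (2 * Real.cosh (s - c)))) _ s :=
    ((hasDerivAt_const s (1 : ℝ)).fun_div
      (((hasDerivAt_id s).sub_const c).cosh.const_mul 2)
      (mul_ne_zero two_ne_zero hcosh)).const_mul a
  rw [deriv_const_mul_arctan_exp_sub, deriv_neg_add_log_exp_add_exp, h.deriv]
  simp only [id]
  field_simp
  ring

lemma deriv_deriv_log_exp_add_exp_add_sq (b c s : ℝ) :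
    deriv (deriv fun s => -s + Real.log (Real.exp (2 * s) + Real.exp (2 * c)) + b) s +
      (deriv (fun s => -s + Real.log (Real.exp (2 * s) + Real.exp (2 * c)) + b) s) ^ 2 - 1 = 0 := by
  have hcosh : Real.cosh (s - c) ≠ 0 := (Real.cosh_pos _).ne'
  have h : HasDerivAt (fun s => Real.sinh (s - c) / Real.cosh (s - c)) _ s :=
    ((hasDerivAt_id s).sub_const c).sinh.fun_div ((hasDerivAt_id s).sub_const c).cosh hcosh
  rw [deriv_neg_add_log_exp_add_exp, h.deriv]
  simp only [id]
  field_simp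
  ring

theorem stmt_0 (c₁ c₂ c₃ c₄ c₅ c₆ : ℝ)
    (hc : 4 * Real.exp (2 * c₁) = c₂ ^ 2 + c₄ ^ 2)
    (γ₁ γ₂ γ₃ : ℝ → ℝ)
    (hγ₁ : γ₁ = fun s => Real.exp (-c₁) * c₂ * Real.arctan (Real.exp (s - c₁)) + c₃)
    (hγ₂ : γ₂ = fun s => Real.exp (-c₁) * c₄ * Real.arctan (Real.exp (s - c₁)) + c₅)
    (hγ₃ : γ₃ = fun s => -s + Real.log (Real.exp (2 * s) + Real.exp (2 * c₁)) + c₆) :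
    ∀ s : ℝ,
      deriv (deriv γ₁) s + deriv γ₁ s * deriv γ₃ s = 0 ∧
      deriv (deriv γ₂) s + deriv γ₂ s * deriv γ₃ s = 0 ∧
      deriv (deriv γ₃) s + (deriv γ₃ s) ^ 2 - 1 = 0 := by
  subst hγ₁ hγ₂ hγ₃
  exact fun s => ⟨deriv_deriv_arctan_exp_sub_add_mul _ _ _ _ s,
    deriv_deriv_arctan_exp_sub_add_mul _ _ _ _ s, deriv_deriv_log_exp_add_exp_add_sq _ _ s⟩
end

section
/- Let γ = (γ₁, γ₂, γ₃) : ℝ → ℝ³ be a twice continuously differentiable unit-speed curve, i.e. (γ₁')² + (γ₂')² + (γ₃')² = 1, satisfying the semi-symmetric geodesic equations γ₁'' + γ₁'γ₃' = 0, γ₂'' + γ₂'γ₃' = 0, γ₃'' + (γ₃')² − 1 = 0 on ℝ, and suppose there exists s₀ ∈ ℝ with (γ₁'(s₀))² + (γ₂'(s₀))² ≠ 0. Then there exist real constants c₁, c₂, c₃, c₄, c₅, c₆ with 4·e^(2c₁) = c₂² + c₄² such that γ₁(s) = e^(−c₁)·c₂·arctan(e^(s−c₁)) + c₃, γ₂(s)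 = e^(−c₁)·c₄·arctan(e^(s−c₁)) + c₅, and γ₃(s) = −s + ln(e^(2s) + e^(2c₁)) + c₆ for all s ∈ ℝ. -/
/-- A function with vanishing derivative is constant. -/
theorem exists_eq_const_of_hasDerivAt_zero {f : ℝ → ℝ} (hf : ∀ s, HasDerivAt f 0 s) :
    ∃ c, ∀ s, f s = c :=
  ⟨f 0, fun s => is_const_of_deriv_eq_zero (fun x => (hf x).differentiableAt)
    (fun x => (hf x).deriv) s 0⟩

/-- Two functions with the same derivative differ by a constant. -/
theorem exists_eq_add_const_of_hasDerivAt {f g f' : ℝ → ℝ} (hf : ∀ s, HasDerivAt f (f' s) s)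
    (hg : ∀ s, HasDerivAt g (f' s) s) : ∃ c, ∀ s, f s = g s + c := by
  obtain ⟨c, hc⟩ := exists_eq_const_of_hasDerivAt_zero (f := fun s => f s - g s) fun s => ((hf s).sub (hg s)).congr_deriv (sub_self _)
  exact ⟨c, fun s => by linarith [hc s]⟩

theorem hasDerivAt_exp_neg_mul_arctan_exp_sub (b c s : ℝ) :
    HasDerivAt (fun s => Real.exp (-c) * b * Real.arctan (Real.exp (s - c)))
      (b * Real.exp s / (Real.exp (2 * s) + Real.exp (2 * c))) s := by
  have h := ((((hasDerivAt_id s).sub_const c).exp).arctan).const_mul (Real.exp (-c) * b)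
  refine h.congr_deriv ?_
  simp only [id, two_mul, Real.exp_add, Real.exp_sub, Real.exp_neg]
  have := Real.exp_pos s
  have := Real.exp_pos c
  field_simp
  ring

theorem ContDiff.hasDerivAt_deriv_deriv {f : ℝ → ℝ} (hf : ContDiff ℝ 2 f) (s : ℝ) :
    HasDerivAt (deriv f) (deriv (deriv f) s) s := by
  have h : ContDiff ℝ 1 (deriv f) := ((contDiff_succ_iff_deriv (n := 1)).1 hf).2.2
  exact (h.differentiable one_ne_zero s).hasDerivAt

theorem ContDiff.hasDerivAt_deriv {f : ℝ → ℝ} (hf : ContDiff ℝ 2 f) (s : ℝ) :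
    HasDerivAt f (deriv f s) s :=
  (hf.differentiable two_ne_zero s).hasDerivAt

/-- If `f'' + f' g' = 0`, then `f' e ^ g` is constant. -/
theorem exists_deriv_mul_exp_eq_const {f g : ℝ → ℝ} (hf : ContDiff ℝ 2 f) (hg : ContDiff ℝ 2 g)
    (h : ∀ s, deriv (deriv f) s + deriv f s * deriv g s = 0) :
    ∃ c, ∀ s, deriv f s * Real.exp (g s) = c :=
  exists_eq_const_of_hasDerivAt_zero fun s => by
    refine ((hf.hasDerivAt_deriv_deriv s).mul (hg.hasDerivAt_deriv s).exp).congr_deriv ?_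
    linear_combination Real.exp (g s) * h s

/-- If `g'' + (g')² = 1`, then `e ^ g` is a combination of `e ^ s` and `e ^ (-s)`. -/
theorem exists_one_add_deriv_mul_exp_eq_const {g : ℝ → ℝ} (hg : ContDiff ℝ 2 g)
    (h : ∀ s, deriv (deriv g) s + (deriv g s) ^ 2 - 1 = 0) :
    ∃ A B, (∀ s, (1 + deriv g s) * Real.exp (g s) = 2 * A * Real.exp s) ∧
      ∀ s, (1 - deriv g s) * Real.exp (g s) * Real.exp s = 2 * B := by
  obtain ⟨A, hA⟩ := exists_eq_const_of_hasDerivAt_zero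
    (f := fun s => (1 + deriv g s) * Real.exp (g s - s)) fun s => by
      refine (((hg.hasDerivAt_deriv_deriv s).const_add 1).mul
        ((hg.hasDerivAt_deriv s).sub (hasDerivAt_id s)).exp).congr_deriv ?_
      simp only [Pi.sub_apply, id]
      linear_combination Real.exp (g s - s) * h s
  obtain ⟨B, hB⟩ := exists_eq_const_of_hasDerivAt_zero
    (f := fun s => (1 - deriv g s) * Real.exp (g s + s)) fun s => by
      refine (((hg.hasDerivAt_deriv_deriv s).const_sub 1).mul
        ((hg.hasDerivAt_deriv s).add (hasDerivAt_id s)).exp).congr_deriv ?_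
      simp only [Pi.add_apply, id]
      linear_combination -Real.exp (g s + s) * h s
  refine ⟨A / 2, B / 2, fun s => ?_, fun s => ?_⟩
  · rw [← hA s, Real.exp_sub]
    have := Real.exp_pos s
    field_simp
  · rw [← hB s, Real.exp_add]
    ring

theorem stmt_2 (γ₁ γ₂ γ₃ : ℝ → ℝ)
    (h₁ : ContDiff ℝ 2 γ₁) (h₂ : ContDiff ℝ 2 γ₂) (h₃ : ContDiff ℝ 2 γ₃)
    (hunit : ∀ s : ℝ, (deriv γ₁ s) ^ 2 + (deriv γ₂ s) ^ 2 + (deriv γ₃ s) ^ 2 = 1)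
    (heq₁ : ∀ s : ℝ, deriv (deriv γ₁) s + deriv γ₁ s * deriv γ₃ s = 0)
    (heq₂ : ∀ s : ℝ, deriv (deriv γ₂) s + deriv γ₂ s * deriv γ₃ s = 0)
    (heq₃ : ∀ s : ℝ, deriv (deriv γ₃) s + (deriv γ₃ s) ^ 2 - 1 = 0)
    (s₀ : ℝ) (hnd : (deriv γ₁ s₀) ^ 2 + (deriv γ₂ s₀) ^ 2 ≠ 0) :
    ∃ c₁ c₂ c₃ c₄ c₅ c₆ : ℝ,
      4 * Real.exp (2 * c₁) = c₂ ^ 2 + c₄ ^ 2 ∧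
      (∀ s : ℝ, γ₁ s = Real.exp (-c₁) * c₂ * Real.arctan (Real.exp (s - c₁)) + c₃) ∧
      (∀ s : ℝ, γ₂ s = Real.exp (-c₁) * c₄ * Real.arctan (Real.exp (s - c₁)) + c₅) ∧
      (∀ s : ℝ, γ₃ s = -s + Real.log (Real.exp (2 * s) + Real.exp (2 * c₁)) + c₆) := by
  obtain ⟨A, B, hA, hB⟩ := exists_one_add_deriv_mul_exp_eq_const h₃ heq₃
  obtain ⟨P, hP⟩ := exists_deriv_mul_exp_eq_const h₁ h₃ heq₁
  obtain ⟨Q, hQ⟩ := exists_deriv_mul_exp_eq_const h₂ h₃ heq₂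
  have hw : (deriv γ₃ s₀) ^ 2 < 1 := by
    have : 0 < (deriv γ₁ s₀) ^ 2 + (deriv γ₂ s₀) ^ 2 := lt_of_le_of_ne (by positivity) hnd.symm
    linarith [hunit s₀]
  obtain ⟨hw₁, hw₂⟩ := abs_lt.1 ((sq_lt_one_iff_abs_lt_one _).1 hw)
  have hApos : 0 < A := by
    have h : 0 < 2 * A * Real.exp s₀ := hA s₀ ▸ mul_pos (by linarith) (Real.exp_pos _)
    linarith [pos_of_mul_pos_left h (Real.exp_pos _).le]
  have hBpos : 0 < B := by
    have h : 0 < 2 * B :=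
      hB s₀ ▸ mul_pos (mul_pos (by linarith) (Real.exp_pos _)) (Real.exp_pos _)
    linarith
  have hc : Real.exp (2 * (Real.log (B / A) / 2)) = B / A := by
    rw [mul_div_cancel₀ _ two_ne_zero, Real.exp_log (div_pos hBpos hApos)]
  have hE : ∀ s, Real.exp (γ₃ s) * Real.exp s = A * (Real.exp (2 * s) + B / A) := fun s => by
    rw [two_mul, Real.exp_add, mul_add, mul_div_cancel₀ _ hApos.ne']
    linear_combination (Real.exp s * hA s + hB s) / 2
  have horizontal : ∀ (f : ℝ → ℝ) (p : ℝ), ContDiff ℝ 2 f →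
      (∀ s, deriv f s * Real.exp (γ₃ s) = p) → ∃ c, ∀ s,
        f s = Real.exp (-(Real.log (B / A) / 2)) * (p / A) *
          Real.arctan (Real.exp (s - Real.log (B / A) / 2)) + c := fun f p hf hp => by
    refine exists_eq_add_const_of_hasDerivAt hf.hasDerivAt_deriv fun s => ?_
    refine (hasDerivAt_exp_neg_mul_arctan_exp_sub (p / A) _ s).congr_deriv ?_
    have hpos : 0 < Real.exp (2 * s) + B / A := add_pos (Real.exp_pos _) (div_pos hBpos hApos)
    rw [hc, div_eq_iff hpos.ne', div_mul_eq_mul_div, div_eq_iff hApos.ne']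
    linear_combination deriv f s * hE s - Real.exp s * hp s
  obtain ⟨c₃, hc₃⟩ := horizontal γ₁ P h₁ hP
  obtain ⟨c₅, hc₅⟩ := horizontal γ₂ Q h₂ hQ
  refine ⟨Real.log (B / A) / 2, P / A, c₃, Q / A, c₅, Real.log A, ?_, hc₃, hc₅, fun s => ?_⟩
  · have hPQ : P ^ 2 + Q ^ 2 = 4 * A * B := by
      have hs : (1 - deriv γ₃ s₀ ^ 2) * Real.exp (γ₃ s₀) ^ 2 = 4 * A * B := by
        apply mul_right_cancel₀ (Real.exp_pos s₀).ne'
        linear_combination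
          (1 - deriv γ₃ s₀) * Real.exp (γ₃ s₀) * Real.exp s₀ * hA s₀ +
            2 * A * Real.exp s₀ * hB s₀
      rw [← hP s₀, ← hQ s₀]
      linear_combination hs + Real.exp (γ₃ s₀) ^ 2 * hunit s₀
    rw [hc]
    field_simp
    linear_combination -hPQ
  · have hpos : 0 < Real.exp (2 * s) + B / A := add_pos (Real.exp_pos _) (div_pos hBpos hApos)
    have h := congrArg Real.log (hE s)
    rw [← Real.exp_add, Real.log_exp, Real.log_mul hApos.ne' hpos.ne'] at h
    rw [hc]
    linarith
end

section
/- Let γ₁, γ₂, γ₃ : ℝ → ℝ be twice continuously differentiable functions satisfying (γ₁')² + (γ₂')² + (γ₃' − γ₁'γ₂)² = 4 and γ₃'' − (γ₁'γ₂)' = (1/2)·((γ₁')² + (γ₂')²) on ℝ, and suppose |γ₃'(s₀) − γ₁'(s₀)·γ₂(s₀)| < 2 for some s₀ ∈ ℝ. Then there exists a real constant c₁ such that for all s ∈ ℝ: γ₃'(s) − γ₁'(s)·γ₂(s) = 2·(e^(2s) − e^(4c₁)) / (e^(2s) + e^(4c₁)) and (γ₁'(s))² + (γ₂'(s))² = 16·e^(2s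 + 4c₁) / (e^(2s) + e^(4c₁))². -/
/-- The explicit solutions of the Riccati equation `f' = (4 - f²) / 2` with values in `(-2, 2)`. -/
theorem hasDerivAt_riccati_solution {B : ℝ} (hB : 0 < B) (s : ℝ) :
    HasDerivAt (fun t => 2 * (Real.exp (2 * t) - B) / (Real.exp (2 * t) + B))
      (1 / 2 * (4 - (2 * (Real.exp (2 * s) - B) / (Real.exp (2 * s) + B)) ^ 2)) s := by
  have hpos : Real.exp (2 * s) + B ≠ 0 := by positivity
  have hexp : HasDerivAt (fun t : ℝ => Real.exp (2 * t)) (Real.exp (2 * s) * (2 * 1)) s :=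
    ((hasDerivAt_id s).const_mul 2).exp
  refine (((hexp.sub_const B).const_mul 2).fun_div (hexp.add_const B) hpos).congr_deriv ?_
  field_simp
  ring

theorem riccati_solution_mem_Icc {A B : ℝ} (hA : 0 < A) (hB : 0 < B) :
    2 * (A - B) / (A + B) ∈ Set.Icc (-2 : ℝ) 2 := by
  have h : 0 < A + B := by positivity
  constructor
  · rw [le_div_iff₀ h]; linarith
  · rw [div_le_iff₀ h]; linarith

theorem lipschitzOnWith_riccati :
    LipschitzOnWith 2 (fun x : ℝ => 1 / 2 * (4 - x ^ 2)) (Set.Icc (-2) 2) := by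
  refine LipschitzOnWith.of_dist_le_mul fun x hx y hy => ?_
  obtain ⟨hx₁, hx₂⟩ := hx
  obtain ⟨hy₁, hy₂⟩ := hy
  have hsum : |x + y| ≤ 4 := abs_le.2 ⟨by linarith, by linarith⟩
  rw [Real.dist_eq, Real.dist_eq,
    show 1 / 2 * (4 - x ^ 2) - 1 / 2 * (4 - y ^ 2) = -(1 / 2) * ((x + y) * (x - y)) by ring,
    abs_mul, abs_mul, abs_neg, abs_of_pos (by norm_num : (0 : ℝ) < 1 / 2)]
  have := mul_le_mul_of_nonneg_right hsum (abs_nonneg (x - y))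
  norm_num
  linarith

/-- A solution of `f' = (4 - f²) / 2` with values in `[-2, 2]` that is not constantly `±2`. -/
theorem exists_eq_riccati_solution {f : ℝ → ℝ}
    (hf : ∀ s, HasDerivAt f (1 / 2 * (4 - f s ^ 2)) s) (hbd : ∀ s, f s ∈ Set.Icc (-2 : ℝ) 2)
    {s₀ : ℝ} (hs₀ : |f s₀| < 2) :
    ∃ B > 0, ∀ s, f s = 2 * (Real.exp (2 * s) - B) / (Real.exp (2 * s) + B) := by
  obtain ⟨hlo, hhi⟩ := abs_lt.1 hs₀
  have hlo' : 0 < 2 + f s₀ := by linarith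
  have hhi' : 0 < 2 - f s₀ := by linarith
  have hB : 0 < Real.exp (2 * s₀) * (2 - f s₀) / (2 + f s₀) := by positivity
  refine ⟨_, hB, fun s => ?_⟩
  refine congrFun (ODE_solution_unique_univ (v := fun _ x => 1 / 2 * (4 - x ^ 2))
    (s := fun _ => Set.Icc (-2) 2) (t₀ := s₀) (fun _ => lipschitzOnWith_riccati)
    (fun t => ⟨hf t, hbd t⟩)
    (fun t => ⟨hasDerivAt_riccati_solution hB t,
      riccati_solution_mem_Icc (Real.exp_pos _) hB⟩) ?_) s
  have hE := Real.exp_pos (2 * s₀)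
  rw [eq_div_iff (by positivity)]
  field_simp
  ring


theorem stmt_9 (γ₁ γ₂ γ₃ : ℝ → ℝ)
    (h₁ : ContDiff ℝ 2 γ₁) (h₂ : ContDiff ℝ 2 γ₂) (h₃ : ContDiff ℝ 2 γ₃)
    (hunit : ∀ s : ℝ, (deriv γ₁ s) ^ 2 + (deriv γ₂ s) ^ 2 +
        (deriv γ₃ s - deriv γ₁ s * γ₂ s) ^ 2 = 4)
    (hgeo : ∀ s : ℝ, deriv (deriv γ₃) s - deriv (fun t => deriv γ₁ t * γ₂ t) s =
        (1 / 2) * ((deriv γ₁ s) ^ 2 + (deriv γ₂ s) ^ 2))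
    (s₀ : ℝ) (hnd : |deriv γ₃ s₀ - deriv γ₁ s₀ * γ₂ s₀| < 2) :
    ∃ c₁ : ℝ, ∀ s : ℝ,
      deriv γ₃ s - deriv γ₁ s * γ₂ s =
        2 * (Real.exp (2 * s) - Real.exp (4 * c₁)) /
          (Real.exp (2 * s) + Real.exp (4 * c₁)) ∧
      (deriv γ₁ s) ^ 2 + (deriv γ₂ s) ^ 2 =
        16 * Real.exp (2 * s + 4 * c₁) /
          (Real.exp (2 * s) + Real.exp (4 * c₁)) ^ 2 := by
  have hd₁ : Differentiable ℝ (deriv γ₁) := h₁.differentiable_deriv_two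
  have hd₃ : Differentiable ℝ (deriv γ₃) := h₃.differentiable_deriv_two
  have hd₂ : Differentiable ℝ γ₂ := h₂.differentiable (by norm_num)
  have hf : ∀ s, HasDerivAt (fun t => deriv γ₃ t - deriv γ₁ t * γ₂ t)
      (1 / 2 * (4 - (deriv γ₃ s - deriv γ₁ s * γ₂ s) ^ 2)) s := fun s => by
    refine ((hd₃ s).hasDerivAt.fun_sub ((hd₁ s).fun_mul (hd₂ s)).hasDerivAt).congr_deriv ?_
    rw [hgeo s, ← hunit s]
    ring
  have hbd : ∀ s, deriv γ₃ s - deriv γ₁ s * γ₂ s ∈ Set.Icc (-2 : ℝ) 2 := fun s => by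
    refine abs_le_of_sq_le_sq' ?_ zero_le_two
    linarith [hunit s, sq_nonneg (deriv γ₁ s), sq_nonneg (deriv γ₂ s)]
  obtain ⟨B, hB, hsol⟩ := exists_eq_riccati_solution hf hbd hnd
  refine ⟨Real.log B / 4, fun s => ?_⟩
  have hexp : Real.exp (4 * (Real.log B / 4)) = B := by
    rw [mul_div_cancel₀ _ (by norm_num), Real.exp_log hB]
  have hs := hsol s
  rw [Real.exp_add, hexp]
  refine ⟨hs, ?_⟩
  have hu := hunit s
  rw [hs] at hu
  have hpos : Real.exp (2 * s) + B ≠ 0 := by positivity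
  rw [eq_sub_of_add_eq hu]
  field_simp
  ring
end

section
/- Let c₂ > 0 and c₃ be real constants and define γ₃ : ℝ → ℝ by γ₃(s) = c₂·e^s / √(e^(c₃ + 4s) + 1). Then γ₃(s) > 0 for all s, and γ₃ satisfies the differential equation γ₃''(s)·γ₃(s) − 3·(γ₃'(s))² + 2·γ₃(s)² = 0 for all s ∈ ℝ. -/
/-- The quotient `c * e ^ s / √(e ^ (d + 4 * s) + 1)` has logarithmic derivative
`(1 - e ^ (d + 4 * s)) / (1 + e ^ (d + 4 * s))`. -/
theorem hasDerivAt_exp_div_sqrt_exp_add_one (c d s : ℝ) :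
    HasDerivAt (fun s => c * Real.exp s / Real.sqrt (Real.exp (d + 4 * s) + 1))
      (c * Real.exp s / Real.sqrt (Real.exp (d + 4 * s) + 1) *
        ((1 - Real.exp (d + 4 * s)) / (1 + Real.exp (d + 4 * s)))) s := by
  have hpos : 0 < Real.exp (d + 4 * s) + 1 := by positivity
  have hexp : HasDerivAt (fun s => Real.exp (d + 4 * s)) (Real.exp (d + 4 * s) * 4) s := by
    simpa using (((hasDerivAt_id s).const_mul 4).const_add d).exp
  have hsqrt := Real.sqrt_pos.2 hpos
  have hsq := Real.sq_sqrt hpos.le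
  refine (((Real.hasDerivAt_exp s).const_mul c).fun_div ((hexp.add_const 1).sqrt hpos.ne')
    hsqrt.ne').congr_deriv ?_
  have hE' : Real.exp (d + 4 * s) = Real.sqrt (Real.exp (d + 4 * s) + 1) ^ 2 - 1 := by linarith
  generalize Real.sqrt (Real.exp (d + 4 * s) + 1) = r at *
  rw [hE', add_sub_cancel]
  field_simp
  ring

/-- The derivative of `(1 - e ^ (d + 4 * s)) / (1 + e ^ (d + 4 * s))`. -/
theorem hasDerivAt_one_sub_exp_div_one_add_exp (d s : ℝ) :
    HasDerivAt (fun s => (1 - Real.exp (d + 4 * s)) / (1 + Real.exp (d + 4 * s)))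
      (-8 * Real.exp (d + 4 * s) / (1 + Real.exp (d + 4 * s)) ^ 2) s := by
  have hpos : 0 < 1 + Real.exp (d + 4 * s) := by positivity
  have hexp : HasDerivAt (fun s => Real.exp (d + 4 * s)) (Real.exp (d + 4 * s) * 4) s := by
    simpa using (((hasDerivAt_id s).const_mul 4).const_add d).exp
  refine ((hexp.const_sub 1).fun_div (hexp.const_add 1) hpos.ne').congr_deriv ?_
  ring

theorem stmt_10 (c₂ c₃ : ℝ) (hc₂ : c₂ > 0) (γ₃ : ℝ → ℝ)
    (hγ₃ : γ₃ = fun s => c₂ * Real.exp s / Real.sqrt (Real.exp (c₃ + 4 * s) + 1)) :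
    ∀ s : ℝ,
      γ₃ s > 0 ∧
      deriv (deriv γ₃) s * γ₃ s - 3 * (deriv γ₃ s) ^ 2 + 2 * (γ₃ s) ^ 2 = 0 := by
  intro s
  have hder (t : ℝ) : HasDerivAt γ₃
      (γ₃ t * ((1 - Real.exp (c₃ + 4 * t)) / (1 + Real.exp (c₃ + 4 * t)))) t := by
    rw [hγ₃]
    exact hasDerivAt_exp_div_sqrt_exp_add_one c₂ c₃ t
  have hderiv : deriv γ₃ = fun t =>
      γ₃ t * ((1 - Real.exp (c₃ + 4 * t)) / (1 + Real.exp (c₃ + 4 * t))) :=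
    funext fun t => (hder t).deriv
  have hderiv₂ := ((hder s).fun_mul (hasDerivAt_one_sub_exp_div_one_add_exp c₃ s)).deriv
  refine ⟨by rw [hγ₃]; positivity, ?_⟩
  rw [hderiv, hderiv₂]
  have hpos : 0 < 1 + Real.exp (c₃ + 4 * s) := by positivity
  field_simp
  ring
end

section
/- Let γ₃ : ℝ → ℝ be twice continuously differentiable with γ₃(s) > 0 for all s, satisfying γ₃''(s)·γ₃(s) − 3·(γ₃'(s))² + 2·γ₃(s)² = 0 for all s ∈ ℝ, and suppose |γ₃'(s₀)| < γ₃(s₀) for some s₀ ∈ ℝ. Then there exist real constants c₂ > 0 and c₃ such that γ₃(s) = c₂·e^s / √(e^(c₃ + 4s) + 1) for all s ∈ ℝ. -/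
/-- First integrals of `f'' f - 3 f'² + 2 f² = 0`: for `ε = ±1`, the quantity
`exp (-2εs) (f - ε f') / f³` is constant. -/
theorem exp_mul_sub_deriv_div_cube_const {f : ℝ → ℝ} (hf : ContDiff ℝ 2 f)
    (hpos : ∀ s, f s > 0)
    (hode : ∀ s, deriv (deriv f) s * f s - 3 * (deriv f s) ^ 2 + 2 * (f s) ^ 2 = 0)
    {ε : ℝ} (hε : ε ^ 2 = 1) (s t : ℝ) :
    Real.exp (-2 * ε * s) * (f s - ε * deriv f s) / f s ^ 3 =
      Real.exp (-2 * ε * t) * (f t - ε * deriv f t) / f t ^ 3 := by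
  have hf₁ : ∀ s, HasDerivAt f (deriv f s) s := fun s =>
    (hf.differentiable (by norm_num) s).hasDerivAt
  have hf₂ : ∀ s, HasDerivAt (deriv f) (deriv (deriv f) s) s := fun s =>
    (hf.differentiable_deriv_two s).hasDerivAt
  have key : ∀ s, HasDerivAt
      (fun s => Real.exp (-2 * ε * s) * (f s - ε * deriv f s) / f s ^ 3) 0 s := by
    intro s
    have hexp : HasDerivAt (fun s => Real.exp (-2 * ε * s))
        (Real.exp (-2 * ε * s) * (-2 * ε)) s := by
      simpa using ((hasDerivAt_id s).const_mul (-2 * ε)).exp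
    have hne := (hpos s).ne'
    refine ((hexp.mul ((hf₁ s).sub ((hf₂ s).const_mul ε))).div ((hf₁ s).pow 3)
      (pow_ne_zero 3 hne)).congr_deriv ?_
    rw [div_eq_zero_iff]
    left
    simp only [Pi.mul_apply, Pi.sub_apply, Pi.pow_apply]
    push_cast
    linear_combination (-ε * Real.exp (-2 * ε * s) * f s ^ 2) * hode s +
      2 * Real.exp (-2 * ε * s) * f s ^ 3 * deriv f s * hε
  exact is_const_of_deriv_eq_zero (fun s => (key s).differentiableAt)
    (fun s => (key s).deriv) s t

theorem stmt_11 (γ₃ : ℝ → ℝ) (h : ContDiff ℝ 2 γ₃)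
    (hpos : ∀ s : ℝ, γ₃ s > 0)
    (hode : ∀ s : ℝ, deriv (deriv γ₃) s * γ₃ s - 3 * (deriv γ₃ s) ^ 2 + 2 * (γ₃ s) ^ 2 = 0)
    (s₀ : ℝ) (hnd : |deriv γ₃ s₀| < γ₃ s₀) :
    ∃ c₂ c₃ : ℝ, c₂ > 0 ∧
      ∀ s : ℝ, γ₃ s = c₂ * Real.exp s / Real.sqrt (Real.exp (c₃ + 4 * s) + 1) := by
  obtain ⟨hlo, hhi⟩ := abs_lt.mp hnd
  have hp₀ := hpos s₀
  have hA := fun s => exp_mul_sub_deriv_div_cube_const h hpos hode (ε := 1) (by norm_num) s s₀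
  have hB := fun s => exp_mul_sub_deriv_div_cube_const h hpos hode (ε := -1) (by norm_num) s s₀
  have hA₀ : 0 < Real.exp (-2 * 1 * s₀) * (γ₃ s₀ - 1 * deriv γ₃ s₀) / γ₃ s₀ ^ 3 :=
    div_pos (mul_pos (Real.exp_pos _) (by linarith)) (by positivity)
  have hB₀ : 0 < Real.exp (-2 * -1 * s₀) * (γ₃ s₀ - -1 * deriv γ₃ s₀) / γ₃ s₀ ^ 3 :=
    div_pos (mul_pos (Real.exp_pos _) (by linarith)) (by positivity)
  generalize Real.exp (-2 * 1 * s₀) * (γ₃ s₀ - 1 * deriv γ₃ s₀) / γ₃ s₀ ^ 3 = A at hA hA₀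
  generalize Real.exp (-2 * -1 * s₀) * (γ₃ s₀ - -1 * deriv γ₃ s₀) / γ₃ s₀ ^ 3 = B at hB hB₀
  refine ⟨Real.sqrt (2 / B), Real.log (A / B), by positivity, fun s => ?_⟩
  have hp := hpos s
  have hAs := hA s
  have hBs := hB s
  rw [show -2 * 1 * s = -(s + s) by ring, Real.exp_neg, Real.exp_add,
    div_eq_iff (by positivity)] at hAs
  rw [show -2 * -1 * s = s + s by ring, Real.exp_add, div_eq_iff (by positivity)] at hBs
  rw [Real.exp_add, Real.exp_log (by positivity), show 4 * s = s + s + (s + s) by ring,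
    Real.exp_add, Real.exp_add]
  have he := Real.exp_pos s
  generalize Real.exp s = E at *
  field_simp at hAs
  have hsq : γ₃ s ^ 2 * (A * E ^ 4 + B) = 2 * E ^ 2 := by
    apply mul_right_cancel₀ hp.ne'
    linear_combination -E ^ 2 * hAs - hBs
  rw [eq_div_iff (by positivity)]
  refine (pow_left_inj₀ (by positivity) (by positivity) two_ne_zero).mp ?_
  rw [mul_pow, mul_pow, Real.sq_sqrt (by positivity), Real.sq_sqrt (by positivity)]
  field_simp
  linear_combination hsq
end
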